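/- arXiv:1306.1787 — 2 statements merged into one kernel-verified Lean document; each statement's English description precedes it below -/
import Mathlib

section
/- Let d ∈ ℙ and let Δ be a (d−1)-dimensional simplicial complex. Then Δ is vertex-decomposable if and only if Δ is (d)-Macaulay decomposable, where (d) denotes the 1-tuple whose single entry is d. -/
open Finset

/-- The vertex set of a finite simplicial complex, given as its finite set of faces. -/
def vertexSet {α : Type*} [DecidableEq α] (Δ : Finset (Finset α)) : Finset α := Δ.sup id

/-- `Δ` is a (finite) simplicial complex: a nonempty collection of finite subsets
closed under taking subsets.  (Every member of some face then automatically spans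
a face, so the vertex condition is automatic.) -/
def IsSimplicialComplex {α : Type*} (Δ : Finset (Finset α)) : Prop :=
  Δ.Nonempty ∧ ∀ F ∈ Δ, ∀ G ⊆ F, G ∈ Δ

/-- The deletion `dl_Δ(x)` of the vertex `x` from `Δ`. -/
def del {α : Type*} [DecidableEq α] (Δ : Finset (Finset α)) (x : α) : Finset (Finset α) :=
  Δ.filter fun τ => x ∉ τ

/-- The link `lk_Δ(x)` of the vertex `x` in `Δ`. -/
def lk {α : Type*} [DecidableEq α] (Δ : Finset (Finset α)) (x : α) : Finset (Finset α) :=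
  Δ.filter fun τ => x ∉ τ ∧ insert x τ ∈ Δ

/-- `F` is a facet (maximal face) of `Δ`. -/
def IsFacet {α : Type*} (Δ : Finset (Finset α)) (F : Finset α) : Prop :=
  F ∈ Δ ∧ ∀ G ∈ Δ, F ⊆ G → G = F

/-- The simplicial complex `⟨ℱ⟩` generated by a collection `ℱ` of faces. -/
def generatedComplex {α : Type*} [DecidableEq α] (S : Finset (Finset α)) :
    Finset (Finset α) :=
  insert ∅ (S.biUnion Finset.powerset)

/-- `(V 0, …, V (n-1))` is an ordered partition of `W` into nonempty parts. -/
def IsOrderedPartition {α : Type*} [DecidableEq α] {n : ℕ} (V : Fin n → Finset α)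
    (W : Finset α) : Prop :=
  (∀ i, (V i).Nonempty) ∧ (∀ i j, i ≠ j → Disjoint (V i) (V j)) ∧
    Finset.univ.biUnion V = W

/-- `Γ` is an `a`-rib of `Δ`: there is an ordered partition `V` of the vertex set
of `Δ` such that `Γ` is generated by the faces `F` of `Δ` with `|F ∩ V i| = a i`
for every `i`. -/
def IsRib {α : Type*} [DecidableEq α] {n : ℕ} (a : Fin n → ℕ) (Δ Γ : Finset (Finset α)) :
    Prop :=
  ∃ V : Fin n → Finset α, IsOrderedPartition V (vertexSet Δ) ∧
    (Δ.filter fun F => ∀ i, (F ∩ V i).card = a i).Nonempty ∧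
    Γ = generatedComplex (Δ.filter fun F => ∀ i, (F ∩ V i).card = a i)

/-- `Γ` is an `a`-rib of a simplex. -/
def IsRibOfSimplex {α : Type*} [DecidableEq α] {n : ℕ} (a : Fin n → ℕ)
    (Γ : Finset (Finset α)) : Prop :=
  ∃ F : Finset α, F.Nonempty ∧ IsRib a F.powerset Γ

/-- Vertex decomposability, in the non-pure sense of Björner and Wachs. -/
inductive VertexDecomposable {α : Type*} [DecidableEq α] : Finset (Finset α) → Prop
  | simplex (F : Finset α) (hF : F.Nonempty) : VertexDecomposable F.powerset
  | ofEmpty : VertexDecomposable {∅}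
  | shed (Δ : Finset (Finset α)) (x : α) (hC : IsSimplicialComplex Δ) (hx : {x} ∈ Δ)
      (hdl : VertexDecomposable (del Δ x)) (hlk : VertexDecomposable (lk Δ x))
      (hfac : ∀ F, IsFacet (lk Δ x) F → ¬ IsFacet (del Δ x) F) :
      VertexDecomposable Δ

/-- `a`-Macaulay decomposability. -/
inductive MacaulayDecomposable {α : Type*} [DecidableEq α] {n : ℕ} :
    (Fin n → ℕ) → Finset (Finset α) → Prop
  | rib (a : Fin n → ℕ) (Γ : Finset (Finset α)) (h : IsRibOfSimplex a Γ) :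
      MacaulayDecomposable a Γ
  | shed (a a' : Fin n → ℕ) (Δ : Finset (Finset α)) (x : α)
      (hC : IsSimplicialComplex Δ) (hx : {x} ∈ Δ) (hlt : a' < a)
      (hdl : MacaulayDecomposable a (del Δ x))
      (hlk : MacaulayDecomposable a' (lk Δ x))
      (hfac : ∀ F, IsFacet (lk Δ x) F → ¬ IsFacet (del Δ x) F) :
      MacaulayDecomposable a Δ

/-- The faces with at most `d` vertices of the simplex on `F`. -/
def simplexSkeleton {α : Type*} (F : Finset α) (d : ℕ) : Finset (Finset α) :=
  F.powerset.filter fun G => G.card ≤ d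

theorem mem_simplexSkeleton {α : Type*} {F G : Finset α} {d : ℕ} :
    G ∈ simplexSkeleton F d ↔ G ⊆ F ∧ G.card ≤ d := by
  simp [simplexSkeleton]

theorem simplexSkeleton_zero {α : Type*} (F : Finset α) : simplexSkeleton F 0 = {∅} := by
  ext G
  simp only [mem_simplexSkeleton, nonpos_iff_eq_zero, card_eq_zero, mem_singleton]
  exact ⟨fun h => h.2, fun h => ⟨h ▸ empty_subset F, h⟩⟩

theorem simplexSkeleton_card {α : Type*} (F : Finset α) :
    simplexSkeleton F F.card = F.powerset := by
  ext G
  simpa [mem_simplexSkeleton] using card_le_card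

section

variable {α : Type*} [DecidableEq α]

theorem vertexSet_powerset (F : Finset α) : vertexSet F.powerset = F := by
  ext x
  simp only [vertexSet, mem_sup, mem_powerset, id]
  exact ⟨fun ⟨G, hG, hx⟩ => hG hx, fun hx => ⟨F, Subset.refl F, hx⟩⟩

theorem generatedComplex_filter_card {F : Finset α} {d : ℕ} (hd : d ≤ F.card) :
    generatedComplex (F.powerset.filter fun G => G.card = d) = simplexSkeleton F d := by
  ext G
  simp only [generatedComplex, mem_insert, mem_biUnion, mem_filter, mem_powerset,
    mem_simplexSkeleton]
  constructor
  · rintro (rfl | ⟨H, ⟨hHF, rfl⟩, hGH⟩)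
    · simp
    · exact ⟨hGH.trans hHF, card_le_card hGH⟩
  · rintro ⟨hGF, hGd⟩
    obtain ⟨H, hGH, hHF, hHd⟩ := exists_subsuperset_card_eq hGF hGd hd
    exact Or.inr ⟨H, ⟨hHF, hHd⟩, hGH⟩

theorem isRibOfSimplex_one_iff {a : Fin 1 → ℕ} {Γ : Finset (Finset α)} :
    IsRibOfSimplex a Γ ↔
      ∃ F : Finset α, F.Nonempty ∧ a 0 ≤ F.card ∧ Γ = simplexSkeleton F (a 0) := by
  have hfilter (V : Fin 1 → Finset α) :
      ((V 0).powerset.filter fun G => ∀ i, (G ∩ V i).card = a i) =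
        (V 0).powerset.filter fun G => G.card = a 0 := by
    refine filter_congr fun G hG => ?_
    rw [Fin.forall_fin_one, inter_eq_left.2 (mem_powerset.1 hG)]
  constructor
  · rintro ⟨F, hF, V, ⟨-, -, hV⟩, ⟨G, hG⟩, rfl⟩
    obtain rfl : V 0 = F := by simpa [vertexSet_powerset] using hV
    rw [hfilter] at hG ⊢
    obtain ⟨hGF, hGa⟩ := mem_filter.1 hG
    have hle : a 0 ≤ (V 0).card := hGa ▸ card_le_card (mem_powerset.1 hGF)
    exact ⟨V 0, hF, hle, generatedComplex_filter_card hle⟩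
  · rintro ⟨F, hF, hle, rfl⟩
    have hF' := hfilter fun _ => F
    refine ⟨F, hF, fun _ => F, ⟨fun _ => hF, fun i j hij => (hij (Subsingleton.elim i j)).elim,
      by simp [vertexSet_powerset]⟩, ?_, ?_⟩
    · rw [hF']
      obtain ⟨G, hGF, hG⟩ := exists_subset_card_eq hle
      exact ⟨G, by simp [hGF, hG]⟩
    · rw [hF', generatedComplex_filter_card hle]

theorem del_simplexSkeleton_insert {x : α} {F : Finset α} (hx : x ∉ F) (d : ℕ) :
    del (simplexSkeleton (insert x F) d) x = simplexSkeleton F d := by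
  ext G
  simp only [del, mem_filter, mem_simplexSkeleton]
  constructor
  · rintro ⟨⟨hG, hd⟩, hxG⟩
    exact ⟨(subset_insert_iff_of_notMem hxG).1 hG, hd⟩
  · rintro ⟨hG, hd⟩
    exact ⟨⟨hG.trans (subset_insert x F), hd⟩, fun h => hx (hG h)⟩

theorem lk_simplexSkeleton_insert {x : α} {F : Finset α} (hx : x ∉ F) (d : ℕ) :
    lk (simplexSkeleton (insert x F) (d + 1)) x = simplexSkeleton F d := by
  ext G
  simp only [lk, mem_filter, mem_simplexSkeleton]
  constructor
  · rintro ⟨⟨hG, -⟩, hxG, -, hd⟩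
    rw [card_insert_of_notMem hxG] at hd
    exact ⟨(subset_insert_iff_of_notMem hxG).1 hG, by omega⟩
  · rintro ⟨hG, hd⟩
    have hxG : x ∉ G := fun h => hx (hG h)
    rw [card_insert_of_notMem hxG]
    exact ⟨⟨hG.trans (subset_insert x F), by omega⟩, hxG, insert_subset_insert x hG, by omega⟩

theorem vertexDecomposable_simplexSkeleton (F : Finset α) :
    ∀ d ≤ F.card, VertexDecomposable (simplexSkeleton F d) := by
  induction F using Finset.induction_on with
  | empty =>
    intro d hd
    obtain rfl : d = 0 := by simpa using hd
    rw [simplexSkeleton_zero]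
    exact .ofEmpty
  | insert x F hx ih =>
    rintro (_ | d) hd
    · rw [simplexSkeleton_zero]
      exact .ofEmpty
    rcases hd.eq_or_lt with hd | hd
    · rw [hd, simplexSkeleton_card]
      exact .simplex _ (insert_nonempty x F)
    rw [card_insert_of_notMem hx] at hd
    refine .shed _ x ⟨⟨∅, by simp [mem_simplexSkeleton]⟩, fun G hG H hHG => ?_⟩
      (by simp [mem_simplexSkeleton]) ?_ ?_ ?_
    · rw [mem_simplexSkeleton] at hG ⊢
      exact ⟨hHG.trans hG.1, (card_le_card hHG).trans hG.2⟩
    · rw [del_simplexSkeleton_insert hx]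
      exact ih _ (by omega)
    · rw [lk_simplexSkeleton_insert hx]
      exact ih _ (by omega)
    · rw [del_simplexSkeleton_insert hx, lk_simplexSkeleton_insert hx]
      rintro G ⟨hG, -⟩ ⟨-, hmax⟩
      rw [mem_simplexSkeleton] at hG
      obtain ⟨H, hGH, hHF, hHd⟩ :=
        exists_subsuperset_card_eq hG.1 (hG.2.trans d.le_succ) (show d + 1 ≤ F.card by omega)
      have hHG := hmax H (mem_simplexSkeleton.2 ⟨hHF, hHd.le⟩) hGH
      rw [hHG] at hHd
      omega

theorem MacaulayDecomposable.vertexDecomposable {a : Fin 1 → ℕ} {Δ : Finset (Finset α)}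
    (h : MacaulayDecomposable a Δ) : VertexDecomposable Δ := by
  induction h with
  | rib a Γ h =>
    obtain ⟨F, -, hle, rfl⟩ := isRibOfSimplex_one_iff.1 h
    exact vertexDecomposable_simplexSkeleton F _ hle
  | shed a a' Δ x hC hx _ _ _ hfac ihdl ihlk => exact .shed Δ x hC hx ihdl ihlk hfac

/-- Deleting a shedding vertex does not lower the dimension. -/
theorem exists_mem_del_card_eq {Δ : Finset (Finset α)} (hC : IsSimplicialComplex Δ) {x : α}
    (hfac : ∀ F, IsFacet (lk Δ x) F → ¬ IsFacet (del Δ x) F) {d : ℕ}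
    (hle : ∀ F ∈ Δ, F.card ≤ d) (hd : ∃ F ∈ Δ, F.card = d) :
    ∃ F ∈ del Δ x, F.card = d := by
  by_contra! hne
  obtain ⟨F, hF, hFd⟩ := hd
  have hxF : x ∈ F := by
    by_contra hxF
    exact hne F (mem_filter.2 ⟨hF, hxF⟩) hFd
  have hcard := card_erase_add_one hxF
  have hdel : F.erase x ∈ del Δ x :=
    mem_filter.2 ⟨hC.2 F hF _ (erase_subset x F), notMem_erase x F⟩
  have hlk : F.erase x ∈ lk Δ x :=
    mem_filter.2 ⟨hC.2 F hF _ (erase_subset x F), notMem_erase x F, by rwa [insert_erase hxF]⟩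
  have hmax : ∀ G ∈ del Δ x, F.erase x ⊆ G → G = F.erase x := by
    intro G hG hFG
    have h₁ := hle G (mem_filter.1 hG).1
    have h₂ := hne G hG
    exact (eq_of_subset_of_card_le hFG (by omega)).symm
  have hsub : ∀ G ∈ lk Δ x, G ∈ del Δ x := fun G hG =>
    mem_filter.2 ⟨(mem_filter.1 hG).1, (mem_filter.1 hG).2.1⟩
  exact hfac _ ⟨hlk, fun G hG => hmax G (hsub G hG)⟩ ⟨hdel, hmax⟩

theorem VertexDecomposable.macaulayDecomposable [Nonempty α] {Δ : Finset (Finset α)}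
    (h : VertexDecomposable Δ) :
    ∀ d : ℕ, (∀ F ∈ Δ, F.card ≤ d) → (∃ F ∈ Δ, F.card = d) →
      MacaulayDecomposable (fun _ : Fin 1 => d) Δ := by
  induction h with
  | simplex F hF =>
    rintro d hle ⟨G, hG, rfl⟩
    have hFG : F.card = G.card :=
      (hle F (mem_powerset_self F)).antisymm (card_le_card (mem_powerset.1 hG))
    refine .rib _ _ (isRibOfSimplex_one_iff.2 ⟨F, hF, hFG.ge, ?_⟩)
    rw [← hFG, simplexSkeleton_card]
  | ofEmpty =>
    rintro d - ⟨G, hG, rfl⟩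
    obtain rfl := mem_singleton.1 hG
    obtain ⟨x⟩ := ‹Nonempty α›
    exact .rib _ _ (isRibOfSimplex_one_iff.2
      ⟨{x}, singleton_nonempty x, Nat.zero_le _, (simplexSkeleton_zero {x}).symm⟩)
  | shed Δ x hC hx _ _ hfac ihdl ihlk =>
    intro d hle hd
    have hne : (lk Δ x).Nonempty :=
      ⟨∅, mem_filter.2 ⟨hC.2 _ hx _ (empty_subset _), notMem_empty x, hx⟩⟩
    obtain ⟨G, hG, hmax⟩ := exists_max_image (lk Δ x) card hne
    obtain ⟨-, hxG, hGx⟩ := mem_filter.1 hG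
    have hlt : G.card < d := by simpa [card_insert_of_notMem hxG] using hle _ hGx
    refine .shed _ (fun _ => G.card) Δ x hC hx ?_
      (ihdl d (fun F hF => hle F (mem_filter.1 hF).1) (exists_mem_del_card_eq hC hfac hle hd))
      (ihlk _ hmax ⟨G, hG, rfl⟩) hfac
    exact Pi.lt_def.2 ⟨fun _ => hlt.le, 0, hlt⟩

end

/-- A `(d-1)`-dimensional simplicial complex is
vertex-decomposable iff it is `(d)`-Macaulay decomposable. -/
theorem vertexDecomposable_iff_macaulayDecomposable {α : Type*} [DecidableEq α]
    (d : ℕ) (hd : 0 < d) (Δ : Finset (Finset α)) (hC : IsSimplicialComplex Δ)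
    (hdim_le : ∀ F ∈ Δ, F.card ≤ d) (hdim : ∃ F ∈ Δ, F.card = d) :
    VertexDecomposable Δ ↔ MacaulayDecomposable (fun _ : Fin 1 => d) Δ := by
  refine ⟨fun h => ?_, MacaulayDecomposable.vertexDecomposable⟩
  obtain ⟨F, hF, hFd⟩ := hdim
  obtain ⟨x, -⟩ : F.Nonempty := card_pos.1 (hFd ▸ hd)
  have : Nonempty α := ⟨x⟩
  exact h.macaulayDecomposable d hdim_le ⟨F, hF, hFd⟩
end

section
/- Let a ∈ ℕ^n and let Δ' be a simplicial complex. If there exists a vertex x' of Δ' such that dl_{Δ'}(x') is pure and a-Macaulay decomposable, and lk_{Δ'}(x') is pure and a'-Macaulay decomposable for some a' ∈ ℕ^n with a' ⋖ a (i.e. a' < a componentwise and |a| = |a'| + 1), then Δ' is pure and a-Macaulay decomposable. -/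
open Finset

/-- `Δ` is pure: all facets have the same dimension. -/
def IsPureComplex {α : Type*} (Δ : Finset (Finset α)) : Prop :=
  ∀ F G, IsFacet Δ F → IsFacet Δ G → F.card = G.card

theorem vertexSet_powerset_s16 {α : Type*} [DecidableEq α] (W : Finset α) :
    vertexSet W.powerset = W :=
  le_antisymm (Finset.sup_le fun _ hF => Finset.mem_powerset.1 hF)
    (Finset.le_sup (f := id) (Finset.mem_powerset_self W))

theorem IsOrderedPartition.card_eq_sum {α : Type*} [DecidableEq α] {n : ℕ}
    {V : Fin n → Finset α} {W F : Finset α} (hV : IsOrderedPartition V W) (hF : F ⊆ W) :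
    F.card = ∑ i, (F ∩ V i).card := by
  obtain ⟨-, hdisj, rfl⟩ := hV
  rw [← Finset.card_biUnion, ← Finset.inter_biUnion, Finset.inter_eq_left.2 hF]
  exact fun i _ j _ hij =>
    (hdisj i j hij).mono Finset.inter_subset_right Finset.inter_subset_right

theorem IsRibOfSimplex.exists_isFacet_card {α : Type*} [DecidableEq α] {n : ℕ}
    {a : Fin n → ℕ} {Γ : Finset (Finset α)} (h : IsRibOfSimplex a Γ) :
    ∃ F, IsFacet Γ F ∧ F.card = ∑ i, a i := by
  obtain ⟨W, -, V, hV, ⟨F, hF⟩, rfl⟩ := h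
  rw [vertexSet_powerset_s16] at hV
  have hcard : ∀ G ∈ W.powerset.filter (fun F => ∀ i, (F ∩ V i).card = a i),
      G.card = ∑ i, a i := by
    intro G hG
    obtain ⟨hGW, hGa⟩ := Finset.mem_filter.1 hG
    rw [hV.card_eq_sum (Finset.mem_powerset.1 hGW)]
    exact Finset.sum_congr rfl fun i _ => hGa i
  refine ⟨F, ⟨?_, fun G hG hFG => ?_⟩, hcard F hF⟩
  · exact Finset.mem_insert_of_mem
      (Finset.mem_biUnion.2 ⟨F, hF, Finset.mem_powerset_self F⟩)
  · rcases Finset.mem_insert.1 hG with rfl | hG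
    · exact (Finset.subset_empty.1 hFG).symm
    · obtain ⟨H, hH, hGH⟩ := Finset.mem_biUnion.1 hG
      refine (Finset.eq_of_subset_of_card_le hFG ?_).symm
      rw [hcard F hF, ← hcard H hH]
      exact Finset.card_le_card (Finset.mem_powerset.1 hGH)

/-- A facet of the deletion of `x` is a facet of `Δ` unless it is also a facet of the link. -/
theorem IsFacet.of_del {α : Type*} [DecidableEq α] {Δ : Finset (Finset α)} {x : α}
    {F : Finset α} (hC : IsSimplicialComplex Δ) (hF : IsFacet (del Δ x) F)
    (hlk : ¬ IsFacet (lk Δ x) F) : IsFacet Δ F := by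
  obtain ⟨hFΔ, hxF⟩ := Finset.mem_filter.1 hF.1
  refine ⟨hFΔ, fun G hG hFG => ?_⟩
  by_cases hxG : x ∈ G
  · refine absurd ⟨Finset.mem_filter.2 ⟨hFΔ, hxF, ?_⟩, fun H hH hFH => ?_⟩ hlk
    · exact hC.2 G hG _ (Finset.insert_subset hxG hFG)
    · obtain ⟨hHΔ, hxH, -⟩ := Finset.mem_filter.1 hH
      exact hF.2 H (Finset.mem_filter.2 ⟨hHΔ, hxH⟩) hFH
  · exact hF.2 G (Finset.mem_filter.2 ⟨hG, hxG⟩) hFG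

theorem MacaulayDecomposable.exists_isFacet_card {α : Type*} [DecidableEq α] {n : ℕ}
    {a : Fin n → ℕ} {Δ : Finset (Finset α)} (h : MacaulayDecomposable a Δ) :
    ∃ F, IsFacet Δ F ∧ F.card = ∑ i, a i := by
  induction h with
  | rib a Γ h => exact h.exists_isFacet_card
  | shed a a' Δ x hC hx hlt hdl hlk hfac ihdl _ =>
    obtain ⟨F, hF, hcard⟩ := ihdl
    exact ⟨F, hF.of_del hC fun h => hfac F h hF, hcard⟩

theorem IsFacet.del {α : Type*} [DecidableEq α] {Δ : Finset (Finset α)} {x : α}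
    {F : Finset α} (hF : IsFacet Δ F) (hx : x ∉ F) : IsFacet (del Δ x) F :=
  ⟨Finset.mem_filter.2 ⟨hF.1, hx⟩, fun G hG => hF.2 G (Finset.mem_filter.1 hG).1⟩

theorem IsFacet.lk_erase {α : Type*} [DecidableEq α] {Δ : Finset (Finset α)} {x : α}
    {F : Finset α} (hC : IsSimplicialComplex Δ) (hF : IsFacet Δ F) (hx : x ∈ F) :
    IsFacet (lk Δ x) (F.erase x) := by
  refine ⟨Finset.mem_filter.2 ⟨hC.2 F hF.1 _ (Finset.erase_subset x F),
    Finset.notMem_erase x F, ?_⟩, fun G hG hFG => ?_⟩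
  · rw [Finset.insert_erase hx]
    exact hF.1
  · obtain ⟨-, hxG, hGΔ⟩ := Finset.mem_filter.1 hG
    rw [← hF.2 _ hGΔ (Finset.subset_insert_iff.2 hFG), Finset.erase_insert hxG]

/-- If for some vertex `x'` of `Δ'` the deletion is pure and
`a`-Macaulay decomposable and the link is pure and `a'`-Macaulay decomposable
with `a' ⋖ a`, then `Δ'` is pure and `a`-Macaulay decomposable. -/
theorem pure_macaulayDecomposable_of_del_lk {α : Type*} [DecidableEq α] {n : ℕ}
    (a a' : Fin n → ℕ) (Δ' : Finset (Finset α)) (hC : IsSimplicialComplex Δ')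
    (x' : α) (hx : {x'} ∈ Δ')
    (hlt : a' < a) (hsum : (∑ i, a i) = (∑ i, a' i) + 1)
    (hdlp : IsPureComplex (del Δ' x')) (hdlm : MacaulayDecomposable a (del Δ' x'))
    (hlkp : IsPureComplex (lk Δ' x')) (hlkm : MacaulayDecomposable a' (lk Δ' x')) :
    IsPureComplex Δ' ∧ MacaulayDecomposable a Δ' := by
  obtain ⟨D, hD, hDcard⟩ := hdlm.exists_isFacet_card
  obtain ⟨L, hL, hLcard⟩ := hlkm.exists_isFacet_card
  have hcard : ∀ F, IsFacet Δ' F → F.card = ∑ i, a i := by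
    intro F hF
    by_cases hxF : x' ∈ F
    · rw [← Finset.card_erase_add_one hxF, hlkp _ _ (hF.lk_erase hC hxF) hL, hLcard, hsum]
    · rw [hdlp _ _ (hF.del hxF) hD, hDcard]
  refine ⟨fun F G hF hG => (hcard F hF).trans (hcard G hG).symm,
    .shed a a' Δ' x' hC hx hlt hdlm hlkm fun F hFlk hFdl => ?_⟩
  have hFL := hlkp F L hFlk hL
  have hFD := hdlp F D hFdl hD
  omega
end
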